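/- arXiv:1302.6757 — 2 statements merged into one kernel-verified Lean document; each statement's English description precedes it below -/
import Mathlib

section
/- Let σ_P, σ_R, p > 0 and r > σ_R²/2. Define K(u) = ∫₀^u (v + σ_P/σ_R)^{−2r/σ_R²} exp( (2(p − rσ_P/σ_R)/σ_R²) · (v + σ_P/σ_R)^{−1} ) dv for u ≥ 0. Then K(u) converges to a finite limit K(∞) as u → ∞, and the function h(u) = 1 − K(u)/K(∞) is twice continuously differentiable on (0, ∞), satisfies ½ (σ_P + σ_R u)² h''(u) + (p + r u) h'(u) = 0 for all u > 0, and moreover h(0) = 1 and lim_{u→∞} h(u) = 0. -/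
open Real Filter MeasureTheory Set

/-- The scale density `(v + c)^(-a) * exp (b / (v + c))`. -/
noncomputable def scaleDensity (a b c v : ℝ) : ℝ :=
  (v + c) ^ (-a) * Real.exp (b * (v + c)⁻¹)

lemma scaleDensity_pos {a b c v : ℝ} (hv : 0 < v + c) : 0 < scaleDensity a b c v :=
  mul_pos (Real.rpow_pos_of_pos hv _) (Real.exp_pos _)

lemma contDiffOn_scaleDensity (a b c : ℝ) {n : WithTop ℕ∞} :
    ContDiffOn ℝ n (scaleDensity a b c) (Ioi (-c)) := by
  have hne : ∀ v ∈ Ioi (-c), v + c ≠ 0 := fun v hv => by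
    have : -c < v := hv
    linarith
  have hadd : ContDiffOn ℝ n (fun v : ℝ => v + c) (Ioi (-c)) := by fun_prop
  exact (hadd.rpow_const_of_ne hne).mul (contDiffOn_const.mul (hadd.inv hne)).exp

lemma hasDerivAt_scaleDensity (a b c : ℝ) {v : ℝ} (hv : 0 < v + c) :
    HasDerivAt (scaleDensity a b c)
      (-(a / (v + c) + b / (v + c) ^ 2) * scaleDensity a b c v) v := by
  have hadd : HasDerivAt (fun v : ℝ => v + c) 1 v := (hasDerivAt_id v).add_const c
  have hderiv := (hadd.rpow_const (p := -a) (Or.inl hv.ne')).mul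
    ((hadd.fun_inv hv.ne').const_mul b).exp
  refine hderiv.congr_deriv ?_
  rw [scaleDensity, Real.rpow_sub_one hv.ne']
  field_simp
  ring

lemma integrableOn_scaleDensity {a c : ℝ} (b : ℝ) (ha : 1 < a) (hc : 0 < c) :
    IntegrableOn (scaleDensity a b c) (Ioi 0) := by
  have hpow : IntegrableOn (fun v : ℝ => (v + c) ^ (-a)) (Ioi 0) :=
    integrableOn_add_rpow_Ioi_of_lt (by linarith) (by linarith)
  have hcont : ContinuousOn (scaleDensity a b c) (Ioi 0) :=
    (contDiffOn_scaleDensity (n := 0) a b c).continuousOn.mono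
      (Ioi_subset_Ioi (by linarith))
  refine (hpow.mul_const (Real.exp (|b| * c⁻¹))).mono'
    (hcont.aestronglyMeasurable measurableSet_Ioi) ?_
  refine (ae_restrict_mem measurableSet_Ioi).mono fun v hv => ?_
  have hv : 0 < v := hv
  rw [Real.norm_of_nonneg (scaleDensity_pos (by linarith)).le, scaleDensity]
  have hb : b ≤ |b| := le_abs_self b
  have hle : c ≤ v + c := by linarith
  gcongr

lemma integral_scaleDensity_pos {a c : ℝ} (b : ℝ) (ha : 1 < a) (hc : 0 < c) :
    0 < ∫ v in Ioi 0, scaleDensity a b c v := by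
  have hpos : ∀ v ∈ Ioi (0 : ℝ), 0 < scaleDensity a b c v := fun v hv =>
    scaleDensity_pos (add_pos hv hc)
  rw [setIntegral_pos_iff_support_of_nonneg_ae
    ((ae_restrict_mem measurableSet_Ioi).mono fun v hv => (hpos v hv).le)
    (integrableOn_scaleDensity b ha hc),
    inter_eq_right.mpr fun v hv => Function.mem_support.mpr (hpos v hv).ne']
  simp

lemma hasDerivAt_integral_scaleDensity (a b : ℝ) {c u : ℝ} (hc : 0 < c) (hu : 0 < u) :
    HasDerivAt (fun u => ∫ v in (0 : ℝ)..u, scaleDensity a b c v) (scaleDensity a b c u) u := by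
  have hcont := (contDiffOn_scaleDensity (n := 0) a b c).continuousOn
  have hmem : u ∈ Ioi (-c) := show -c < u by linarith
  refine intervalIntegral.integral_hasDerivAt_right
    (hcont.mono fun v hv => ?_).intervalIntegrable
    (hcont.stronglyMeasurableAtFilter isOpen_Ioi u hmem)
    (hcont.continuousAt (Ioi_mem_nhds hmem))
  rw [uIcc_of_le hu.le] at hv
  exact lt_of_lt_of_le (by linarith) hv.1

/-- Example 3.1 of Yin–Wen, the fully correlated case `ρ = 1`:
the explicit solution `h(u) = 1 - K(u)/K(∞)` of the boundary value problem
`½ (σP + σR u)² h''(u) + (p + r u) h'(u) = 0`, `h(0) = 1`, `h(+∞) = 0`. -/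
theorem ruin_probability_jump_free_fully_correlated
    (σP σR p r : ℝ)
    (hσP : 0 < σP) (hσR : 0 < σR) (hp : 0 < p) (hr : σR ^ 2 / 2 < r)
    (K : ℝ → ℝ)
    (hK : K = fun u => ∫ v in (0 : ℝ)..u,
        (v + σP / σR) ^ (-(2 * r / σR ^ 2)) *
          Real.exp ((2 * (p - r * σP / σR) / σR ^ 2) * (v + σP / σR)⁻¹)) :
    ∃ Kinf : ℝ, Filter.Tendsto K Filter.atTop (nhds Kinf) ∧
      ∀ h : ℝ → ℝ, h = (fun u => 1 - K u / Kinf) →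
        ContDiffOn ℝ 2 h (Set.Ioi 0) ∧
        (∀ u > (0 : ℝ),
          (1 / 2) * (σP + σR * u) ^ 2 * deriv (deriv h) u
            + (p + r * u) * deriv h u = 0) ∧
        h 0 = 1 ∧
        Filter.Tendsto h Filter.atTop (nhds 0) := by
  obtain ⟨c, hc_def⟩ : ∃ c, c = σP / σR := ⟨_, rfl⟩
  obtain ⟨a, ha_def⟩ : ∃ a, a = 2 * r / σR ^ 2 := ⟨_, rfl⟩
  obtain ⟨b, hb_def⟩ : ∃ b, b = 2 * (p - r * σP / σR) / σR ^ 2 := ⟨_, rfl⟩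
  have hc : 0 < c := hc_def ▸ div_pos hσP hσR
  have ha : 1 < a := by
    rw [ha_def, one_lt_div (by positivity)]
    linarith
  replace hK : K = fun u => ∫ v in (0 : ℝ)..u, scaleDensity a b c v := by
    rw [hK, ha_def, hb_def, hc_def]
    rfl
  have hlim : Tendsto K atTop (nhds (∫ v in Ioi 0, scaleDensity a b c v)) := by
    rw [hK]
    exact intervalIntegral_tendsto_integral_Ioi 0 (integrableOn_scaleDensity b ha hc) tendsto_id
  have hL : 0 < ∫ v in Ioi 0, scaleDensity a b c v := integral_scaleDensity_pos b ha hc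
  generalize (∫ v in Ioi 0, scaleDensity a b c v) = L at hlim hL
  refine ⟨L, hlim, fun h hh => ?_⟩
  have hder : ∀ u ∈ Ioi (0 : ℝ), HasDerivAt h (-(scaleDensity a b c u / L)) u := fun u hu => by
    rw [hh, hK]
    exact ((hasDerivAt_integral_scaleDensity a b hc hu).div_const L).const_sub 1
  have hderiv : EqOn (deriv h) (fun u => -(scaleDensity a b c u / L)) (Ioi 0) :=
    fun u hu => (hder u hu).deriv
  refine ⟨?_, fun u hu => ?_, by simp [hh, hK], ?_⟩
  · rw [← one_add_one_eq_two, contDiffOn_succ_iff_deriv_of_isOpen isOpen_Ioi]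
    refine ⟨fun u hu => (hder u hu).differentiableAt.differentiableWithinAt, by simp, ?_⟩
    refine ContDiffOn.congr ?_ hderiv
    exact (((contDiffOn_scaleDensity a b c).mono (Ioi_subset_Ioi (by linarith))).div_const L).neg
  · have hw : 0 < u + c := add_pos hu hc
    rw [(hderiv.eventuallyEq_of_mem (Ioi_mem_nhds hu)).deriv_eq, hderiv hu,
      ((hasDerivAt_scaleDensity a b c hw).div_const L).fun_neg.deriv]
    have hσ : σP + σR * u = σR * (u + c) := by
      rw [hc_def]
      field_simp
      ring
    have hcoef : 1 / 2 * (σP + σR * u) ^ 2 * (a / (u + c) + b / (u + c) ^ 2) = p + r * u := by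
      have hdrift : σR ^ 2 * (a * (u + c) + b) = 2 * (p + r * u) := by
        rw [ha_def, hb_def, hc_def]
        field_simp
        ring
      rw [hσ]
      field_simp
      linarith
    linear_combination (scaleDensity a b c u / L) * hcoef
  · rw [hh]
    simpa [hL.ne'] using (hlim.div_const L).const_sub 1
end

section
/- Let σ_P, σ_R, p, r > 0 and δ > 0, and let β = √((2r/σ_R² − 1)² + 8δ/σ_R²) − 1. For every λ with 0 < λ < β + 1 and every x ∈ ℝ, both integrals defining D(x, λ) and E(x, λ) converge and the values are strictly positive: D(x, λ) > 0 and E(x, λ) > 0. -/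
open Real Filter MeasureTheory Set

/-- The fundamental solution `D(x, λ)` of Paulsen–Gjessing (1997a), used in
Examples 3.2, 4.1 and 4.2 of Yin–Wen:
`D(x,λ) = σP^{-(1+β)} σR^{-(1+λ)} ∫_{arctan(σR x/σP)}^{π/2}
  (cos t)^{β-λ} (σP sin t - σR x cos t)^λ exp(-2pt/(σPσR)) dt`. -/
noncomputable def Dfun (σP σR p β x lam : ℝ) : ℝ :=
  σP ^ (-(1 + β)) * σR ^ (-(1 + lam)) *
    ∫ t in Real.arctan (σR * x / σP)..(Real.pi / 2),
      Real.cos t ^ (β - lam) * (σP * Real.sin t - σR * x * Real.cos t) ^ lam *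
        Real.exp (-2 * p * t / (σP * σR))

/-- The fundamental solution `E(x, λ)` of Paulsen–Gjessing (1997a):
`E(x,λ) = σP^{-(1+β)} σR^{-(1+λ)} ∫_{-π/2}^{arctan(σR x/σP)}
  (cos t)^{β-λ} (σR x cos t - σP sin t)^λ exp(-2pt/(σPσR)) dt`. -/
noncomputable def Efun (σP σR p β x lam : ℝ) : ℝ :=
  σP ^ (-(1 + β)) * σR ^ (-(1 + lam)) *
    ∫ t in (-(Real.pi / 2))..Real.arctan (σR * x / σP),
      Real.cos t ^ (β - lam) * (σR * x * Real.cos t - σP * Real.sin t) ^ lam *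
        Real.exp (-2 * p * t / (σP * σR))

/-- The power `sin t ^ s` is integrable on `[0, c]` for `s > -1` and `c < π`. -/
theorem intervalIntegrable_sin_rpow {s c : ℝ} (hs : -1 < s) (hc : 0 ≤ c) (hcπ : c < Real.pi) :
    IntervalIntegrable (fun t => Real.sin t ^ s) volume 0 c := by
  have hpos : ∀ t ∈ Set.uIcc 0 c, 0 < Real.sinc t := by
    intro t ht
    rw [Set.uIcc_of_le hc] at ht
    rcases ht.1.eq_or_lt with rfl | h
    · simp
    · rw [Real.sinc_of_ne_zero h.ne']
      exact div_pos (Real.sin_pos_of_pos_of_lt_pi h (ht.2.trans_lt hcπ)) h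
  have hcont : ContinuousOn (fun t => Real.sinc t ^ s) (Set.uIcc 0 c) :=
    Real.continuous_sinc.continuousOn.rpow_const fun t ht => Or.inl (hpos t ht).ne'
  refine ((intervalIntegral.intervalIntegrable_rpow' hs).mul_continuousOn hcont).congr ?_
  intro t ht
  have ht0 : 0 < t := by
    rw [Set.uIoc_of_le hc] at ht
    exact ht.1
  have hsin : Real.sin t = t * Real.sinc t := by
    rw [Real.sinc_of_ne_zero ht0.ne', mul_div_cancel₀ _ ht0.ne']
  simp only [hsin]
  rw [Real.mul_rpow ht0.le (hpos t (Set.uIoc_subset_uIcc ht)).le]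

/-- The power `cos t ^ s` is integrable on `[a, π / 2]` for `s > -1` and `-π / 2 < a ≤ π / 2`. -/
theorem intervalIntegrable_cos_rpow {s a : ℝ} (hs : -1 < s) (ha : -(Real.pi / 2) < a)
    (ha' : a ≤ Real.pi / 2) :
    IntervalIntegrable (fun t => Real.cos t ^ s) volume a (Real.pi / 2) := by
  have h := (intervalIntegrable_sin_rpow (c := Real.pi / 2 - a) hs (by linarith)
    (by linarith)).comp_sub_left (Real.pi / 2)
  simpa [Real.sin_pi_div_two_sub] using h.symm

/-- The integrand of `Dfun` is integrable. -/
theorem intervalIntegrable_Dfun_integrand {σP σR p β x lam : ℝ} (hlam : 0 < lam)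
    (hβ : lam < β + 1) :
    IntervalIntegrable
      (fun t => Real.cos t ^ (β - lam) *
        (σP * Real.sin t - σR * x * Real.cos t) ^ lam *
        Real.exp (-2 * p * t / (σP * σR)))
      volume (Real.arctan (σR * x / σP)) (Real.pi / 2) := by
  have hcos := intervalIntegrable_cos_rpow (s := β - lam) (by linarith)
    (Real.neg_pi_div_two_lt_arctan (σR * x / σP)) (Real.arctan_lt_pi_div_two _).le
  have hlin : Continuous fun t => (σP * Real.sin t - σR * x * Real.cos t) ^ lam :=
    Continuous.rpow_const (by fun_prop) fun _ => Or.inr hlam.le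
  exact (hcos.mul_continuousOn hlin.continuousOn).mul_continuousOn
    (Continuous.continuousOn (by fun_prop))

/-- The function `Dfun` is strictly positive. -/
theorem Dfun_pos {σP σR p β x lam : ℝ} (hσP : 0 < σP) (hσR : 0 < σR) (hlam : 0 < lam)
    (hβ : lam < β + 1) : 0 < Dfun σP σR p β x lam := by
  refine mul_pos (mul_pos (Real.rpow_pos_of_pos hσP _) (Real.rpow_pos_of_pos hσR _)) ?_
  refine intervalIntegral.intervalIntegral_pos_of_pos_on
    (intervalIntegrable_Dfun_integrand hlam hβ) (fun t ht => ?_) (Real.arctan_lt_pi_div_two _)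
  have hlow := (Real.neg_pi_div_two_lt_arctan (σR * x / σP)).trans ht.1
  have hcos : 0 < Real.cos t := Real.cos_pos_of_mem_Ioo ⟨hlow, ht.2⟩
  have htan : σR * x / σP < Real.tan t := by
    have := Real.tan_lt_tan_of_lt_of_lt_pi_div_two (Real.neg_pi_div_two_lt_arctan _) ht.2 ht.1
    rwa [Real.tan_arctan] at this
  have hlin : 0 < σP * Real.sin t - σR * x * Real.cos t := by
    rw [Real.tan_eq_sin_div_cos, div_lt_div_iff₀ hσP hcos] at htan
    linarith
  positivity

/-- Reflecting `t` to `-t` turns the integrand of `Efun` into that of `Dfun`. -/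
theorem Efun_integrand_neg (σP σR p β x lam t : ℝ) :
    Real.cos (-t) ^ (β - lam) * (σP * Real.sin (-t) - σR * (-x) * Real.cos (-t)) ^ lam *
        Real.exp (-2 * (-p) * (-t) / (σP * σR)) =
      Real.cos t ^ (β - lam) * (σR * x * Real.cos t - σP * Real.sin t) ^ lam *
        Real.exp (-2 * p * t / (σP * σR)) := by
  rw [Real.cos_neg, Real.sin_neg]
  ring_nf

/-- The function `Efun` is obtained from `Dfun` by changing the signs of `p` and `x`. -/
theorem Efun_eq_Dfun_neg (σP σR p β x lam : ℝ) :
    Efun σP σR p β x lam = Dfun σP σR (-p) β (-x) lam := by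
  have harctan : Real.arctan (σR * (-x) / σP) = -Real.arctan (σR * x / σP) := by
    rw [mul_neg, neg_div, Real.arctan_neg]
  unfold Efun Dfun
  rw [harctan]
  congr 1
  simp only [← Efun_integrand_neg σP σR p β x lam]
  rw [intervalIntegral.integral_comp_neg (fun t => Real.cos t ^ (β - lam) *
    (σP * Real.sin t - σR * (-x) * Real.cos t) ^ lam *
    Real.exp (-2 * (-p) * t / (σP * σR))), neg_neg]

/-- The integrand of `Efun` is integrable. -/
theorem intervalIntegrable_Efun_integrand {σP σR p β x lam : ℝ} (hlam : 0 < lam)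
    (hβ : lam < β + 1) :
    IntervalIntegrable
      (fun t => Real.cos t ^ (β - lam) *
        (σR * x * Real.cos t - σP * Real.sin t) ^ lam *
        Real.exp (-2 * p * t / (σP * σR)))
      volume (-(Real.pi / 2)) (Real.arctan (σR * x / σP)) := by
  have h := (intervalIntegrable_Dfun_integrand (σP := σP) (σR := σR) (p := -p) (x := -x)
    hlam hβ).comp_sub_left 0
  simp only [zero_sub, Efun_integrand_neg] at h
  rw [mul_neg, neg_div, Real.arctan_neg, neg_neg] at h
  exact h.symm

/-- For `0 < λ < β + 1` and any `x`, the integrals defining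
`D(x, λ)` and `E(x, λ)` converge and the values are strictly positive. -/
theorem Dfun_Efun_integrable_pos
    (σP σR p r δ : ℝ)
    (hσP : 0 < σP) (hσR : 0 < σR) (hp : 0 < p) (hr : 0 < r) (hδ : 0 < δ)
    (β : ℝ)
    (hβ : β = Real.sqrt ((2 * r / σR ^ 2 - 1) ^ 2 + 8 * δ / σR ^ 2) - 1) :
    ∀ lam : ℝ, 0 < lam → lam < β + 1 → ∀ x : ℝ,
      IntervalIntegrable
        (fun t => Real.cos t ^ (β - lam) *
          (σP * Real.sin t - σR * x * Real.cos t) ^ lam *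
          Real.exp (-2 * p * t / (σP * σR)))
        MeasureTheory.volume (Real.arctan (σR * x / σP)) (Real.pi / 2) ∧
      IntervalIntegrable
        (fun t => Real.cos t ^ (β - lam) *
          (σR * x * Real.cos t - σP * Real.sin t) ^ lam *
          Real.exp (-2 * p * t / (σP * σR)))
        MeasureTheory.volume (-(Real.pi / 2)) (Real.arctan (σR * x / σP)) ∧
      0 < Dfun σP σR p β x lam ∧ 0 < Efun σP σR p β x lam := by
  intro lam hlam hlt x
  refine ⟨intervalIntegrable_Dfun_integrand hlam hlt, intervalIntegrable_Efun_integrand hlam hlt,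
    Dfun_pos hσP hσR hlam hlt, ?_⟩
  rw [Efun_eq_Dfun_neg]
  exact Dfun_pos hσP hσR hlam hlt
end
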